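/- Suppose n ≥ 1, δ(s,μ) ≤ 0.5, the inexactness vector E = −Aᵀε satisfies ‖s⁻¹∘E‖₂ ≤ 0.1·δ(s,μ), and θ = 1/(4√n). Then with s⁺ = s + Δs + E and μ⁺ = (1−θ)μ, the proximity after the full inexact Newton step and barrier update satisfies δ(s⁺, μ⁺) ≤ 0.5. -/

import Mathlib

open Matrix

/-- Euclidean norm of a vector in `ℝ^k`. -/
noncomputable def norm2 {k : ℕ} (v : Fin k → ℝ) : ℝ := Real.sqrt (∑ i, v i ^ 2)

lemma norm2_nonneg {k : ℕ} (v : Fin k → ℝ) : 0 ≤ norm2 v := Real.sqrt_nonneg _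

lemma norm2_sq {k : ℕ} (v : Fin k → ℝ) : norm2 v ^ 2 = ∑ i, v i ^ 2 :=
  Real.sq_sqrt (Finset.sum_nonneg fun i _ => sq_nonneg (v i))

lemma norm2_eq_norm {k : ℕ} (v : Fin k → ℝ) : norm2 v = ‖WithLp.toLp 2 v‖ := by
  simp [norm2, EuclideanSpace.norm_eq]

lemma norm2_sub_le {k : ℕ} (u v : Fin k → ℝ) : norm2 (u - v) ≤ norm2 u + norm2 v := by
  simp only [norm2_eq_norm, WithLp.toLp_sub]
  exact _root_.norm_sub_le _ _

lemma norm2_smul {k : ℕ} {c : ℝ} (hc : 0 ≤ c) (v : Fin k → ℝ) :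
    norm2 (c • v) = c * norm2 v := by
  rw [norm2_eq_norm, norm2_eq_norm, WithLp.toLp_smul, norm_smul, Real.norm_of_nonneg hc]

lemma abs_apply_le_norm2 {k : ℕ} (v : Fin k → ℝ) (i : Fin k) : |v i| ≤ norm2 v := by
  refine abs_le_of_sq_le_sq ?_ (norm2_nonneg v)
  rw [norm2_sq]
  exact Finset.single_le_sum (f := fun j => v j ^ 2) (fun j _ => sq_nonneg (v j))
    (Finset.mem_univ i)

lemma norm2_mul_le {k : ℕ} (u v : Fin k → ℝ) {c : ℝ} (hc : 0 ≤ c) (hv : ∀ i, |v i| ≤ c) :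
    norm2 (u * v) ≤ c * norm2 u := by
  refine le_of_sq_le_sq ?_ (mul_nonneg hc (norm2_nonneg u))
  rw [mul_pow, norm2_sq, norm2_sq, Finset.mul_sum]
  refine Finset.sum_le_sum fun i _ => ?_
  rw [Pi.mul_apply, mul_pow, mul_comm]
  exact mul_le_mul_of_nonneg_right (sq_le_sq' (abs_le.mp (hv i)).1 (abs_le.mp (hv i)).2)
    (sq_nonneg _)

/-- The negative cross term between `v ∘ v` and `θ e` improves on the triangle inequality. -/
lemma norm2_mul_self_sub_smul_one_sq_le {k : ℕ} (v : Fin k → ℝ) (θ : ℝ) :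
    norm2 (v * v - θ • 1) ^ 2 ≤ norm2 v ^ 4 + k * θ ^ 2 - 2 * θ * norm2 v ^ 2 := by
  have h₁ : norm2 (v * v) ^ 2 ≤ norm2 v ^ 4 := by
    have h := norm2_mul_le v v (norm2_nonneg v) (abs_apply_le_norm2 v)
    calc norm2 (v * v) ^ 2 ≤ (norm2 v * norm2 v) ^ 2 := by
          gcongr
          exact norm2_nonneg _
      _ = norm2 v ^ 4 := by ring
  have h₂ : norm2 (v * v - θ • 1) ^ 2 =
      norm2 (v * v) ^ 2 + k * θ ^ 2 - 2 * θ * norm2 v ^ 2 := by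
    have hk : (k : ℝ) * θ ^ 2 = ∑ _i : Fin k, θ ^ 2 := by simp
    rw [hk, norm2_sq, norm2_sq, norm2_sq, Finset.mul_sum, ← Finset.sum_add_distrib,
      ← Finset.sum_sub_distrib]
    refine Finset.sum_congr rfl fun i _ => ?_
    simp only [Pi.sub_apply, Pi.mul_apply, Pi.smul_apply, Pi.one_apply, smul_eq_mul]
    ring
  linarith

lemma vecMul_injective_of_rank_eq {m n : ℕ} {A : Matrix (Fin m) (Fin n) ℝ} (h : A.rank = m) :
    Function.Injective A.vecMul := by
  rw [Matrix.vecMul_injective_iff, linearIndependent_iff_card_eq_finrank_span, Set.finrank,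
    ← Matrix.rank_eq_finrank_span_row, h, Fintype.card_fin]

lemma isUnit_det_mul_diagonal_mul_transpose {m n : ℕ} {A : Matrix (Fin m) (Fin n) ℝ}
    (h : A.rank = m) {w : Fin n → ℝ} (hw : ∀ i, 0 < w i) :
    IsUnit (A * Matrix.diagonal w * A.transpose).det := by
  have hpd := (Matrix.PosDef.diagonal hw).mul_mul_conjTranspose_same
    (vecMul_injective_of_rank_eq h)
  rw [Matrix.conjTranspose_eq_transpose_of_trivial] at hpd
  exact (Matrix.isUnit_iff_isUnit_det _).mp hpd.isUnit

/-- The scalar inequality behind the update of the proximity: `D` is the old proximity, `a` the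
size of the exact part and `r` the size of the inexact part of the new residual. -/
lemma proximity_scalar_bound {D θ a r : ℝ} (hD : 0 ≤ D) (hD' : D ≤ 1 / 2) (hθ : 0 ≤ θ)
    (hθ' : θ ≤ 1 / 4) (ha : a ^ 2 ≤ D ^ 4 + 1 / 16 - 2 * θ * D ^ 2)
    (hr : r ≤ 3 / 20 * D) : a + r ≤ (1 - θ) / 2 := by
  suffices a ≤ 17 / 40 - θ / 2 by linarith
  refine le_of_sq_le_sq ?_ (by linarith)
  have hD2 : D ^ 2 ≤ 1 / 4 := by nlinarith
  have h4 : D ^ 4 ≤ D ^ 2 / 4 := by nlinarith [sq_nonneg D]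
  rcases le_total θ (1 / 8) with h | h
  · nlinarith [mul_nonneg (sub_nonneg.mpr hD2) (sub_nonneg.mpr h)]
  · nlinarith [mul_nonneg (sq_nonneg D) (sub_nonneg.mpr h), mul_nonneg hθ (sub_nonneg.mpr hθ')]

/-- If `n ≥ 1`, `δ(s,μ) ≤ 0.5`, `‖s⁻¹∘E‖ ≤ 0.1·δ(s,μ)` with `E = -Aᵀε`, and
`θ = 1/(4√n)`, then with `s⁺ = s + Δs + E` and `μ⁺ = (1-θ)μ` we have `δ(s⁺,μ⁺) ≤ 0.5`. -/
theorem stmt3 {m n : ℕ} (hn : 1 ≤ n)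
    (A : Matrix (Fin m) (Fin n) ℝ) (b : Fin m → ℝ)
    (hrank : A.rank = m) (hmn : m ≤ n)
    (s : Fin n → ℝ) (hs : ∀ i, 0 < s i)
    (μ : ℝ) (hμ : 0 < μ)
    (rp : Fin m → ℝ) (hrp : rp = b - μ • A.mulVec s⁻¹)
    (Δy : Fin m → ℝ)
    (hΔy : Δy = (1 / μ) •
      ((A * Matrix.diagonal (fun i => ((s i) ^ 2)⁻¹) * A.transpose)⁻¹).mulVec rp)
    (Δs : Fin n → ℝ) (hΔs : Δs = -(A.transpose.mulVec Δy))
    (δ : ℝ) (hδ : δ = norm2 (s⁻¹ * Δs)) (hδle : δ ≤ 0.5)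
    (ε : Fin m → ℝ) (E : Fin n → ℝ) (hE : E = -(A.transpose.mulVec ε))
    (hEsmall : norm2 (s⁻¹ * E) ≤ 0.1 * δ)
    (sp : Fin n → ℝ) (hsp : sp = s + Δs + E)
    (θ : ℝ) (hθ : θ = 1 / (4 * Real.sqrt n))
    (μp : ℝ) (hμp : μp = (1 - θ) * μ) :
    (1 / μp) * sInf {t : ℝ | ∃ x : Fin n → ℝ, A.mulVec x = b ∧
        t = norm2 (μp • (1 : Fin n → ℝ) - sp * x)} ≤ 0.5 := by
  have hn' : (1 : ℝ) ≤ n := by exact_mod_cast hn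
  have hsqrt : 1 ≤ √(n : ℝ) := Real.one_le_sqrt.mpr hn'
  have hθ0 : 0 ≤ θ := by rw [hθ]; positivity
  have hθ4 : θ ≤ 1 / 4 := by
    rw [hθ]
    exact one_div_le_one_div_of_le (by norm_num) (by linarith)
  have hnθ : (n : ℝ) * θ ^ 2 = 1 / 16 := by
    rw [hθ, div_pow, mul_pow, Real.sq_sqrt (by linarith)]
    field_simp
    norm_num
  have hμp0 : 0 < μp := by rw [hμp]; exact mul_pos (by linarith) hμ
  have hδ0 : 0 ≤ δ := hδ ▸ norm2_nonneg _
  have hδ2 : δ ≤ 1 / 2 := by linarith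
  set d : Fin n → ℝ := s⁻¹ * Δs with hd
  set f : Fin n → ℝ := s⁻¹ * E with hf
  set W : Matrix (Fin n) (Fin n) ℝ := Matrix.diagonal (fun i => ((s i) ^ 2)⁻¹) with hW
  have hdet : IsUnit (A * W * A.transpose).det :=
    isUnit_det_mul_diagonal_mul_transpose hrank fun i => inv_pos.mpr (pow_pos (hs i) 2)
  have hWΔs : A.mulVec (W.mulVec Δs) = -((1 / μ) • rp) := by
    rw [hΔs, Matrix.mulVec_neg, Matrix.mulVec_neg, Matrix.mulVec_mulVec, Matrix.mulVec_mulVec,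
      hΔy, Matrix.mulVec_smul, Matrix.mulVec_mulVec,
      Matrix.mul_nonsing_inv _ hdet, Matrix.one_mulVec]
  have hfeas : A.mulVec (μ • (s⁻¹ - W.mulVec Δs)) = b := by
    rw [Matrix.mulVec_smul, Matrix.mulVec_sub, hWΔs, hrp, sub_neg_eq_add, smul_add, smul_smul,
      mul_one_div_cancel hμ.ne', one_smul, add_sub_cancel]
  have hres : μp • (1 : Fin n → ℝ) - sp * (μ • (s⁻¹ - W.mulVec Δs)) =
      μ • ((d * d - θ • 1) - f * (1 - d)) := by
    ext i
    have hsi := (hs i).ne'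
    simp only [hsp, hμp, hd, hf, hW, Pi.sub_apply, Pi.mul_apply, Pi.smul_apply, Pi.one_apply,
      Pi.add_apply, Pi.inv_apply, smul_eq_mul, Matrix.mulVec_diagonal]
    field_simp
    ring
  have hd1 : ∀ i, |(1 - d) i| ≤ 3 / 2 := fun i => by
    have h := abs_le.mp (abs_apply_le_norm2 d i)
    rw [← hδ] at h
    rw [Pi.sub_apply, Pi.one_apply, abs_le]
    constructor <;> linarith
  have hr : norm2 (f * (1 - d)) ≤ 3 / 20 * δ := by
    linarith [norm2_mul_le f (1 - d) (by norm_num) hd1]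
  have ha := norm2_mul_self_sub_smul_one_sq_le d θ
  rw [hnθ, ← hδ] at ha
  have hsInf : sInf {t : ℝ | ∃ x : Fin n → ℝ, A.mulVec x = b ∧
      t = norm2 (μp • (1 : Fin n → ℝ) - sp * x)} ≤ μ * ((1 - θ) / 2) := by
    refine csInf_le_of_le ⟨0, ?_⟩ ⟨_, hfeas, rfl⟩ ?_
    · rintro t ⟨x, -, rfl⟩
      exact norm2_nonneg _
    · rw [hres, norm2_smul hμ.le]
      exact mul_le_mul_of_nonneg_left ((norm2_sub_le _ _).trans
        (proximity_scalar_bound hδ0 hδ2 hθ0 hθ4 ha hr)) hμ.le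
  rw [one_div_mul_eq_div, div_le_iff₀ hμp0]
  refine hsInf.trans (le_of_eq ?_)
  rw [hμp]
  ring
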